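/- (Exponential convergence, deterministic case.) Under the hypotheses of the main deterministic stabilization theorem — S₁,…,S_m ∈ u(n), T > 0, X_goal ∈ U(n) with det(I + X_goal) ≠ 0, gains f_k > 0, Coron reference controls ū_k with associated T-periodic reference trajectory X̄(t) = X̄_I(t)X_goal, and closed-loop solution X : [0,∞) → U(n) of X' = Σ_k (ū_k(t) + ũ_k(X̄(t)†X, t)) S_k X with X(0) = I, where ũ_k(X̃,t) = f_k Tr(X̃(X̃−I)(X̃+I)^{−3} X̄(t)†S_kX̄(t)) — the convergence of X(jT) to X_goal is exponential: there exist constants c > 0 and λ > 0 such that ‖X(jT) − X_goal‖ ≤ c·e^{−λj} for all j ∈ ℕ, where ‖·‖ is the Frobenius norm. -/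

import Mathlib

open Matrix Filter

attribute [local instance] Matrix.frobeniusNormedAddCommGroup Matrix.frobeniusNormedSpace

/-- The iterated matrices `C_k^j(t)` of the return method:
`C_k^0(t) = S_k`, `C_k^{j+1}(t) = (d/dt) C_k^j(t) + [C_k^j(t), A(t)]`. -/
noncomputable def Cmat {n : ℕ} (A : ℝ → Matrix (Fin n) (Fin n) ℂ)
    (S0 : Matrix (Fin n) (Fin n) ℂ) : ℕ → ℝ → Matrix (Fin n) (Fin n) ℂ
  | 0, _ => S0
  | j + 1, t => deriv (fun s => Cmat A S0 j s) t
      + (Cmat A S0 j t * A t - A t * Cmat A S0 j t)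

/-- The feedback direction matrix `X̃ (X̃ - I) (X̃ + I)⁻³`. -/
noncomputable def fbMat {n : ℕ} (X : Matrix (Fin n) (Fin n) ℂ) : Matrix (Fin n) (Fin n) ℂ :=
  X * (X - 1) * ((X + 1)⁻¹ * (X + 1)⁻¹ * (X + 1)⁻¹)

/-- The feedback law `ũ_k(X̃, t) = f_k Tr (X̃(X̃-I)(X̃+I)⁻³ X̄(t)ᴴ S_k X̄(t))`
(the trace is real; we take its real part). -/
noncomputable def utildeFb {n : ℕ} (f : ℝ) (Sk : Matrix (Fin n) (Fin n) ℂ)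
    (Xbar : ℝ → Matrix (Fin n) (Fin n) ℂ) (Xt : Matrix (Fin n) (Fin n) ℂ) (t : ℝ) : ℝ :=
  f * ((fbMat Xt * ((Xbar t)ᴴ * Sk * Xbar t)).trace).re

/-- The Frobenius norm of a complex matrix. -/
noncomputable def frobNorm {n : ℕ} (A : Matrix (Fin n) (Fin n) ℂ) : ℝ :=
  Real.sqrt (∑ i, ∑ j, ‖A i j‖ ^ 2)

section Helpers

attribute [local instance] Matrix.frobeniusNormedRing Matrix.frobeniusNormedAlgebra

abbrev Mn (n : ℕ) := Matrix (Fin n) (Fin n) ℂ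

lemma cc_mul {n : ℕ} {P Q : ℝ → Mn n} {P' Q' : Mn n} {s : Set ℝ} {t : ℝ}
    (hP : HasDerivWithinAt P P' s t) (hQ : HasDerivWithinAt Q Q' s t) :
    HasDerivWithinAt (fun t => P t * Q t) (P' * Q t + P t * Q') s t :=
  HasDerivWithinAt.mul hP hQ

lemma cc_star {n : ℕ} {P : ℝ → Mn n} {P' : Mn n} {s : Set ℝ} {t : ℝ}
    (hP : HasDerivWithinAt P P' s t) :
    HasDerivWithinAt (fun t => (P t)ᴴ) (P'ᴴ) s t :=
  HasDerivWithinAt.star hP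

lemma cc_skew {n : ℕ} {P Q : ℝ → Mn n} {A : Mn n} {s : Set ℝ} {t : ℝ} (hA : Aᴴ = -A)
    (hP : HasDerivWithinAt P (A * P t) s t) (hQ : HasDerivWithinAt Q (A * Q t) s t) :
    HasDerivWithinAt (fun t => (P t)ᴴ * Q t) 0 s t := by
  refine (cc_mul (cc_star hP) hQ).congr_deriv ?_
  rw [conjTranspose_mul, hA]
  noncomm_ring

lemma cc_const {n : ℕ} (A P Q : ℝ → Mn n) (hA : ∀ t, (A t)ᴴ = -(A t))
    (hP : ∀ t, HasDerivAt P (A t * P t) t) (hQ : ∀ t, HasDerivAt Q (A t * Q t) t) (t s : ℝ) :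
    (P t)ᴴ * Q t = (P s)ᴴ * Q s := by
  have h : ∀ t, HasDerivAt (fun t => (P t)ᴴ * Q t) 0 t := by
    intro t
    exact hasDerivWithinAt_univ.1
      (cc_skew (hA t) (hP t).hasDerivWithinAt (hQ t).hasDerivWithinAt)
  exact is_const_of_deriv_eq_zero (fun t => (h t).differentiableAt) (fun t => (h t).deriv) t s

lemma cc_norm_sq {n : ℕ} (A : Mn n) : ‖A‖ ^ 2 = (Aᴴ * A).trace.re := by
  have h : ‖A‖ = Real.sqrt (∑ i, ∑ j, ‖A i j‖ ^ 2) := by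
    rw [frobenius_norm_def, Real.sqrt_eq_rpow]
    norm_cast
  rw [h, Real.sq_sqrt (by positivity), Finset.sum_comm]
  simp only [trace, diag_apply, mul_apply, conjTranspose_apply, Complex.re_sum]
  refine Finset.sum_congr rfl fun i _ => Finset.sum_congr rfl fun j _ => ?_
  rw [← Complex.normSq_eq_norm_sq, Complex.normSq_apply]
  simp

lemma cc_frob {n : ℕ} (A : Mn n) : frobNorm A = ‖A‖ := by
  rw [frobenius_norm_def, frobNorm, Real.sqrt_eq_rpow]
  norm_cast

/-- real part of the trace as a real linear map -/
noncomputable def rtr (n : ℕ) : Mn n →L[ℝ] ℝ :=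
  LinearMap.toContinuousLinearMap (Complex.reLm.comp (Matrix.traceLinearMap (Fin n) ℝ ℂ))

lemma rtr_apply {n : ℕ} (A : Mn n) : rtr n A = A.trace.re := rfl

lemma rtr_bound (n : ℕ) : ∃ C : ℝ, 0 < C ∧ ∀ A B : Mn n, |rtr n (A * B)| ≤ C * (‖A‖ * ‖B‖) := by
  obtain ⟨C, hC, h⟩ := (rtr n).bound
  refine ⟨C, hC, fun A B => (h (A * B)).trans ?_⟩
  have := Matrix.frobenius_norm_mul A B
  gcongr

lemma rtr_comm {n : ℕ} (A B : Mn n) : rtr n (A * B) = rtr n (B * A) := by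
  rw [rtr_apply, rtr_apply, trace_mul_comm]

lemma rtr_deriv {n : ℕ} {P : ℝ → Mn n} {P' : Mn n} {s : Set ℝ} {t : ℝ}
    (hP : HasDerivWithinAt P P' s t) :
    HasDerivWithinAt (fun t => rtr n (P t)) (rtr n P') s t :=
  (rtr n).hasFDerivAt.comp_hasDerivWithinAt t hP

/-- The reference flow facts. -/
lemma cc_ref {n : ℕ} (A P : ℝ → Mn n) (T : ℝ) (hA : ∀ t, (A t)ᴴ = -(A t))
    (hAper : ∀ t, A (t + T) = A t) (hAodd : ∀ t, A (T - t) = - A t)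
    (hP : ∀ t, HasDerivAt P (A t * P t) t) (hP0 : P 0 = 1) :
    (∀ t, (P t)ᴴ * P t = 1) ∧ (∀ t, P (t + T) = P t) := by
  have hu : ∀ t, (P t)ᴴ * P t = 1 := by
    intro t
    rw [cc_const A P P hA hP hP t 0, hP0]; simp
  have hu' : ∀ t, P t * (P t)ᴴ = 1 := fun t => mul_eq_one_comm.mp (hu t)
  have huniq : ∀ Q : ℝ → Mn n, (∀ t, HasDerivAt Q (A t * Q t) t) → ∀ s, Q s = P s →
      ∀ t, Q t = P t := by
    intro Q hQ s hs t
    have h := cc_const A P Q hA hP hQ t s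
    rw [hs, hu] at h
    calc Q t = P t * ((P t)ᴴ * Q t) := by rw [← mul_assoc, hu', one_mul]
      _ = P t := by rw [h, mul_one]
  have hR : ∀ t, P (T - t) = P t := by
    refine huniq (fun t => P (T - t)) (fun t => ?_) (T / 2) (by ring_nf)
    have h1 := (hP (T - t)).scomp t ((hasDerivAt_id t).const_sub T)
    refine h1.congr_deriv ?_
    rw [hAodd]; simp
  have hT : P (0 + T) = P 0 := by
    have := hR 0
    rw [zero_add]; simpa using this
  refine ⟨hu, huniq (fun t => P (t + T)) (fun t => ?_) 0 hT⟩
  have h1 := (hP (t + T)).scomp t ((hasDerivAt_id t).add_const T)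
  refine h1.congr_deriv ?_
  rw [hAper]; simp

lemma cm_smooth {n : ℕ} (A : ℝ → Mn n) (S0 : Mn n) (hA : ContDiff ℝ (⊤ : ℕ∞) A) (j : ℕ) :
    ContDiff ℝ (⊤ : ℕ∞) (fun s => Cmat A S0 j s) := by
  induction j with
  | zero => exact contDiff_const
  | succ j ih =>
    have h1 : ContDiff ℝ (⊤ : ℕ∞) (deriv (fun s => Cmat A S0 j s)) :=
      (contDiff_infty_iff_deriv.1 ih).2
    have h2 : ContDiff ℝ (⊤ : ℕ∞) (fun t => Cmat A S0 j t * A t) := ContDiff.mul ih hA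
    have h3 : ContDiff ℝ (⊤ : ℕ∞) (fun t => A t * Cmat A S0 j t) := ContDiff.mul hA ih
    exact h1.add (h2.sub h3)

lemma cm_deriv {n : ℕ} (A U : ℝ → Mn n) (S0 Z : Mn n) (hA : ContDiff ℝ (⊤ : ℕ∞) A)
    (hskew : ∀ t, (A t)ᴴ = -(A t)) (hU : ∀ t, HasDerivAt U (A t * U t) t) (j : ℕ) (t : ℝ) :
    HasDerivAt (fun t => rtr n (Z * ((U t)ᴴ * Cmat A S0 j t * U t)))
      (rtr n (Z * ((U t)ᴴ * Cmat A S0 (j + 1) t * U t))) t := by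
  have hC : HasDerivAt (fun s => Cmat A S0 j s) (deriv (fun s => Cmat A S0 j s) t) t :=
    ((cm_smooth A S0 hA j).differentiable (by simp) t).hasDerivAt
  have hUt := (hU t).hasDerivWithinAt (s := Set.univ)
  have h1 := cc_mul (cc_mul (cc_star hUt) (hC.hasDerivWithinAt (s := Set.univ))) hUt
  have h2 := cc_mul (hasDerivWithinAt_const t Set.univ Z) h1
  refine hasDerivWithinAt_univ.1 ((rtr_deriv h2).congr_deriv ?_)
  congr 1
  rw [conjTranspose_mul, hskew]
  simp only [Cmat]
  noncomm_ring

lemma cc_nondeg {n m : ℕ} (A U : ℝ → Mn n) (S : Fin m → Mn n) (Z : Mn n)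
    (hA : ContDiff ℝ (⊤ : ℕ∞) A)
    (hskew : ∀ t, (A t)ᴴ = -(A t)) (hU : ∀ t, HasDerivAt U (A t * U t) t)
    (_hunit : U 0 * (U 0)ᴴ = 1) (hunit' : (U 0)ᴴ * U 0 = 1)
    (hCoron : (Submodule.span ℝ
        {B : Matrix (Fin n) (Fin n) ℂ |
          ∃ (k : Fin m) (j : ℕ), Cmat A (S k) j 0 = B} :
        Set (Matrix (Fin n) (Fin n) ℂ)) = {B | Bᴴ = -B})
    (hZ : Zᴴ = -Z)
    (h0 : ∀ k t, rtr n (Z * ((U t)ᴴ * S k * U t)) = 0) : Z = 0 := by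
  have h1 : ∀ k j t, rtr n (Z * ((U t)ᴴ * Cmat A (S k) j t * U t)) = 0 := by
    intro k j
    induction j with
    | zero => exact h0 k
    | succ j ih =>
      intro t
      have h := cm_deriv A U (S k) Z hA hskew hU j t
      have h' : (fun t => rtr n (Z * ((U t)ᴴ * Cmat A (S k) j t * U t))) = fun _ => 0 :=
        funext ih
      rw [h'] at h
      exact h.unique (hasDerivAt_const t 0)
  have h2 : ∀ B ∈ Submodule.span ℝ {B : Matrix (Fin n) (Fin n) ℂ |
          ∃ (k : Fin m) (j : ℕ), Cmat A (S k) j 0 = B}, rtr n (Z * ((U 0)ᴴ * B * U 0)) = 0 := by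
    intro B hB
    induction hB using Submodule.span_induction with
    | mem x hx => obtain ⟨k, j, rfl⟩ := hx; exact h1 k j 0
    | zero => simp
    | add x y _ _ hx hy => rw [mul_add, add_mul, mul_add, map_add, hx, hy, add_zero]
    | smul a x _ hx =>
      rw [mul_smul_comm, smul_mul_assoc, mul_smul_comm, map_smul, hx, smul_zero]
  have h3 : U 0 * Z * (U 0)ᴴ ∈ Submodule.span ℝ {B : Matrix (Fin n) (Fin n) ℂ |
          ∃ (k : Fin m) (j : ℕ), Cmat A (S k) j 0 = B} := by
    rw [← SetLike.mem_coe, hCoron, Set.mem_ofPred_eq]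
    simp [conjTranspose_mul, hZ, mul_assoc]
  have h4 := h2 _ h3
  have h5 : (U 0)ᴴ * (U 0 * Z * (U 0)ᴴ) * U 0 = Z := by
    calc _ = ((U 0)ᴴ * U 0) * Z * ((U 0)ᴴ * U 0) := by noncomm_ring
      _ = Z := by rw [hunit']; simp
  rw [h5] at h4
  have h6 := cc_norm_sq Z
  rw [hZ, neg_mul, ← rtr_apply, map_neg, h4, neg_zero] at h6
  exact norm_eq_zero.1 (pow_eq_zero_iff (two_ne_zero) |>.1 h6)

lemma cc_compact {E : Type*} [NormedAddCommGroup E] [NormedSpace ℝ E] [FiniteDimensional ℝ E]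
    (K : Set E) (hKc : IsClosed K) (hKs : ∀ (c : ℝ), ∀ Z ∈ K, c • Z ∈ K) (Q : E → ℝ)
    (hQc : Continuous Q) (hsm : ∀ (c : ℝ) Z, Q (c • Z) = c ^ 2 * Q Z)
    (hQpos : ∀ Z ∈ K, Z ≠ 0 → 0 < Q Z) :
    ∃ q : ℝ, 0 < q ∧ ∀ Z ∈ K, q * ‖Z‖ ^ 2 ≤ Q Z := by
  have hK : IsCompact (Metric.sphere (0 : E) 1 ∩ K) := by
    have : ProperSpace E := FiniteDimensional.proper_real E
    exact (isCompact_sphere _ _).inter_right hKc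
  obtain ⟨q, hq, hq'⟩ : ∃ q : ℝ, 0 < q ∧ ∀ Z ∈ Metric.sphere (0 : E) 1 ∩ K, q ≤ Q Z := by
    rcases Set.eq_empty_or_nonempty (Metric.sphere (0 : E) 1 ∩ K) with he | hne
    · exact ⟨1, one_pos, by rw [he]; simp⟩
    · obtain ⟨Z0, hZ0, hmin⟩ := hK.exists_isMinOn hne hQc.continuousOn
      refine ⟨Q Z0, hQpos Z0 hZ0.2 ?_, fun Z hZ => hmin hZ⟩
      rintro rfl
      have := hZ0.1
      simp at this
  refine ⟨q, hq, fun Z hZ => ?_⟩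
  by_cases h0 : Z = 0
  · subst h0
    have := hsm 0 0
    simp only [zero_smul] at this
    rw [this]; simp
  have hnz : ‖Z‖ ≠ 0 := norm_ne_zero_iff.2 h0
  have h1 : q ≤ Q (‖Z‖⁻¹ • Z) := by
    apply hq'
    refine ⟨?_, hKs _ _ hZ⟩
    rw [mem_sphere_zero_iff_norm, norm_smul, norm_inv, norm_norm, inv_mul_cancel₀ hnz]
  rw [hsm] at h1
  calc q * ‖Z‖ ^ 2 ≤ (‖Z‖⁻¹ ^ 2 * Q Z) * ‖Z‖ ^ 2 := by gcongr
    _ = Q Z := by field_simp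

/-- the dissipation density -/
noncomputable def gden {n m : ℕ} (B : Fin m → ℝ → Mn n) (f : Fin m → ℝ) (Z : Mn n) (t : ℝ) : ℝ :=
  ∑ k, (f k / 4) * (rtr n (Z * B k t)) ^ 2

lemma gden_cont {n m : ℕ} (B : Fin m → ℝ → Mn n) (f : Fin m → ℝ) (hB : ∀ k, Continuous (B k)) :
    Continuous (Function.uncurry (gden B f)) := by
  unfold gden
  simp only [Function.uncurry_def]
  refine continuous_finsetSum _ fun k _ => ?_
  refine continuous_const.mul (Continuous.pow ?_ 2)
  exact (rtr n).continuous.comp (continuous_fst.mul ((hB k).comp continuous_snd))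

lemma gden_cont' {n m : ℕ} (B : Fin m → ℝ → Mn n) (f : Fin m → ℝ) (hB : ∀ k, Continuous (B k))
    (Z : Mn n) : Continuous (gden B f Z) := by
  unfold gden
  refine continuous_finsetSum _ fun k _ => ?_
  refine continuous_const.mul (Continuous.pow ?_ 2)
  exact (rtr n).continuous.comp (continuous_const.mul (hB k))

lemma gden_nonneg {n m : ℕ} (B : Fin m → ℝ → Mn n) (f : Fin m → ℝ) (hf : ∀ k, 0 < f k)
    (Z : Mn n) (t : ℝ) : 0 ≤ gden B f Z t :=
  Finset.sum_nonneg fun k _ => by have := hf k; positivity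

lemma gden_per {n m : ℕ} (B : Fin m → ℝ → Mn n) (f : Fin m → ℝ) (T : ℝ)
    (hper : ∀ k t, B k (t + T) = B k t) (Z : Mn n) : Function.Periodic (gden B f Z) T := by
  intro t; simp only [gden, hper]

lemma gden_smul {n m : ℕ} (B : Fin m → ℝ → Mn n) (f : Fin m → ℝ) (c : ℝ)
    (Z : Mn n) (t : ℝ) : gden B f (c • Z) t = c ^ 2 * gden B f Z t := by
  simp only [gden, Finset.mul_sum, smul_mul_assoc, map_smul, smul_eq_mul]
  exact Finset.sum_congr rfl fun k _ => by ring

lemma gden_int_pos {n m : ℕ} (B : Fin m → ℝ → Mn n) (f : Fin m → ℝ) (hf : ∀ k, 0 < f k) (T : ℝ)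
    (hT : 0 < T) (hB : ∀ k, Continuous (B k)) (hper : ∀ k t, B k (t + T) = B k t)
    (hnd : ∀ Z : Mn n, Zᴴ = -Z → (∀ k t, rtr n (Z * B k t) = 0) → Z = 0)
    (Z : Mn n) (hZ : Zᴴ = -Z) (hne : Z ≠ 0) : 0 < ∫ t in (0 : ℝ)..T, gden B f Z t := by
  by_contra hcon
  apply hne
  apply hnd Z hZ
  have hz : ∀ t ∈ Set.Icc 0 T, gden B f Z t = 0 := by
    by_contra h
    push Not at h
    obtain ⟨t, ht, hne⟩ := h
    exact hcon (intervalIntegral.integral_pos hT (gden_cont' B f hB Z).continuousOn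
      (fun x _ => gden_nonneg B f hf Z x)
      ⟨t, ht, lt_of_le_of_ne (gden_nonneg B f hf Z t) (Ne.symm hne)⟩)
  have hz' : ∀ t, gden B f Z t = 0 := by
    intro t
    obtain ⟨y, hy, h⟩ := (gden_per B f T hper Z).exists_mem_Ico₀ hT t
    rw [h]; exact hz y ⟨hy.1, hy.2.le⟩
  intro k t
  have h := (Finset.sum_eq_zero_iff_of_nonneg (fun k _ => by have := hf k; positivity)).1
    (hz' t) k (Finset.mem_univ k)
  have := hf k
  rcases mul_eq_zero.1 h with h | h
  · linarith
  · exact pow_eq_zero_iff (two_ne_zero) |>.1 h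

lemma cc_pos {n m : ℕ} (B : Fin m → ℝ → Mn n) (f : Fin m → ℝ) (hf : ∀ k, 0 < f k) (T : ℝ)
    (hT : 0 < T) (hB : ∀ k, Continuous (B k)) (hper : ∀ k t, B k (t + T) = B k t)
    (hnd : ∀ Z : Mn n, Zᴴ = -Z → (∀ k t, rtr n (Z * B k t) = 0) → Z = 0) :
    ∃ q : ℝ, 0 < q ∧ ∀ Z : Mn n, Zᴴ = -Z →
      q * ‖Z‖ ^ 2 ≤ ∫ t in (0 : ℝ)..T, gden B f Z t := by
  refine cc_compact {Z : Mn n | Zᴴ = -Z} (isClosed_eq continuous_star continuous_neg) ?_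
    (fun Z => ∫ t in (0 : ℝ)..T, gden B f Z t)
    (intervalIntegral.continuous_parametric_intervalIntegral_of_continuous'
      (gden_cont B f hB) 0 T) ?_ ?_
  · intro c Z hZ
    have hZ' : Zᴴ = -Z := hZ
    change (c • Z)ᴴ = -(c • Z)
    simp [conjTranspose_smul, hZ']
  · intro c Z
    simp only [gden_smul, intervalIntegral.integral_const_mul]
  · exact fun Z hZ hne => gden_int_pos B f hf T hT hB hper hnd Z hZ hne

/-- the cubic `W (1 - W^2)` -/
noncomputable def Zf {n : ℕ} (W : Mn n) : Mn n := W - W * W * W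

/-- the closed-loop vector field in the Cayley coordinate -/
noncomputable def Wfield {n m : ℕ} (B : Fin m → ℝ → Mn n) (f : Fin m → ℝ) (W : Mn n) (t : ℝ) :
    Mn n :=
  (1 / 2 : ℝ) • ((1 - W) * (∑ k, (f k / 4 * rtr n (Zf W * B k t)) • B k t) * (1 + W))

lemma V_deriv {n m : ℕ} (B : Fin m → ℝ → Mn n) (f : Fin m → ℝ) (W : ℝ → Mn n) (s : Set ℝ) (t : ℝ)
    (h : HasDerivWithinAt W (Wfield B f (W t) t) s t) :
    HasDerivWithinAt (fun t => rtr n (-(W t * W t))) (-(gden B f (Zf (W t)) t)) s t := by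
  have h1 : HasDerivWithinAt (fun t => -(W t * W t)) _ s t := (cc_mul h h).neg
  refine (rtr_deriv h1).congr_deriv ?_
  have h2 : gden B f (Zf (W t)) t
      = rtr n (Zf (W t) * (∑ k, (f k / 4 * rtr n (Zf (W t) * B k t)) • B k t)) := by
    rw [Finset.mul_sum, map_sum, gden]
    refine Finset.sum_congr rfl fun k _ => ?_
    rw [mul_smul_comm, map_smul, smul_eq_mul]
    ring
  rw [h2, Wfield]
  generalize (∑ k, (f k / 4 * rtr n (Zf (W t) * B k t)) • B k t) = U
  generalize W t = w
  rw [map_neg, map_add, smul_mul_assoc, mul_smul_comm, map_smul, map_smul,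
    rtr_comm _ w, ← add_smul]
  norm_num
  rw [show w * ((1 - w) * U * (1 + w)) = (w * (1 - w) * U) * (1 + w) by noncomm_ring, rtr_comm]
  congr 1
  rw [Zf]
  noncomm_ring

lemma V_eq {n : ℕ} (W : Mn n) (h : Wᴴ = -W) : rtr n (-(W * W)) = ‖W‖ ^ 2 := by
  rw [cc_norm_sq, h, neg_mul]; rfl

lemma V_mono {n m : ℕ} (B : Fin m → ℝ → Mn n) (f : Fin m → ℝ) (hf : ∀ k, 0 < f k) (W : ℝ → Mn n)
    (a b : ℝ) (ha : 0 ≤ a) (hab : a ≤ b)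
    (h : ∀ t ∈ Set.Icc a b, HasDerivWithinAt W (Wfield B f (W t) t) (Set.Ici 0) t) :
    rtr n (-(W b * W b)) ≤ rtr n (-(W a * W a)) := by
  have hd : ∀ t ∈ Set.Icc a b, HasDerivWithinAt (fun t => rtr n (-(W t * W t)))
      (-(gden B f (Zf (W t)) t)) (Set.Ici 0) t := fun t ht => V_deriv B f W _ t (h t ht)
  refine image_le_of_deriv_right_le_deriv_boundary (f := fun t => rtr n (-(W t * W t)))
    (f' := fun t => -(gden B f (Zf (W t)) t)) (a := a) (b := b)
    (B := fun _ => rtr n (-(W a * W a))) (B' := fun _ => 0) ?_ ?_ le_rfl continuousOn_const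
    (fun x _ => hasDerivWithinAt_const _ _ _) (fun x _ => ?_) ⟨hab, le_rfl⟩
  · intro t ht
    exact ((hd t ht).continuousWithinAt).mono fun x hx => ha.trans hx.1
  · intro t ht
    exact (hd t ⟨ht.1, ht.2.le⟩).mono (Set.Ici_subset_Ici.2 (ha.trans ht.1))
  · have := gden_nonneg B f hf (Zf (W x)) x
    linarith

lemma Zf_lower {n : ℕ} : ∃ C : ℝ, 0 < C ∧ ∀ W : Mn n, Wᴴ = -W → ‖W‖ ≤ C * ‖Zf W‖ := by
  obtain ⟨C, hC, h⟩ := rtr_bound n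
  refine ⟨C, hC, fun W hW => ?_⟩
  by_cases h0 : ‖W‖ = 0
  · rw [h0]; positivity
  have hpos : 0 < ‖W‖ := lt_of_le_of_ne (norm_nonneg _) (Ne.symm h0)
  have h1 := h W (Zf W)
  have h2 : rtr n (W * Zf W) = -(‖W‖ ^ 2) - ‖W * W‖ ^ 2 := by
    rw [← V_eq W hW, cc_norm_sq (W * W), conjTranspose_mul, hW, ← rtr_apply, ← map_neg, ← map_sub]
    congr 1
    rw [Zf]; noncomm_ring
  rw [h2] at h1
  have h3 := neg_le_abs (-(‖W‖ ^ 2) - ‖W * W‖ ^ 2)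
  have h4 : ‖W‖ * ‖W‖ ≤ (C * ‖Zf W‖) * ‖W‖ := by nlinarith [sq_nonneg ‖W * W‖]
  exact le_of_mul_le_mul_right h4 hpos

lemma Zf_lip {n : ℕ} (R : ℝ) (W W0 : Mn n) (h : ‖W‖ ≤ R) (h0 : ‖W0‖ ≤ R) :
    ‖Zf W - Zf W0‖ ≤ (1 + 3 * R ^ 2) * ‖W - W0‖ := by
  have e : Zf W - Zf W0 = (W - W0) - ((W - W0) * W * W + W0 * (W - W0) * W + W0 * W0 * (W - W0)) := by
    simp only [Zf]; noncomm_ring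
  have hR : 0 ≤ R := (norm_nonneg _).trans h
  have m3 : ∀ a b c : Mn n, ‖a * b * c‖ ≤ ‖a‖ * ‖b‖ * ‖c‖ := fun a b c =>
    (frobenius_norm_mul _ _).trans (by gcongr; exact frobenius_norm_mul _ _)
  have e1 : ‖(W - W0) * W * W‖ ≤ ‖W - W0‖ * R * R := (m3 _ _ _).trans (by gcongr)
  have e2 : ‖W0 * (W - W0) * W‖ ≤ R * ‖W - W0‖ * R := (m3 _ _ _).trans (by gcongr)
  have e3 : ‖W0 * W0 * (W - W0)‖ ≤ R * R * ‖W - W0‖ := (m3 _ _ _).trans (by gcongr)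
  rw [e]
  refine (norm_sub_le _ _).trans ?_
  have e4 := norm_add₃_le (a := (W - W0) * W * W) (b := W0 * (W - W0) * W) (c := W0 * W0 * (W - W0))
  nlinarith

lemma Wfield_bound {n m : ℕ} (B : Fin m → ℝ → Mn n) (f : Fin m → ℝ) (hf : ∀ k, 0 < f k)
    (b : ℝ) (hb : ∀ k t, ‖B k t‖ ≤ b) (hb0 : 0 ≤ b) (R : ℝ) (W : Mn n) (hW : ‖W‖ ≤ R) (t ε : ℝ) (hε : 0 < ε) :
    ‖Wfield B f W t‖ ≤ ((‖(1 : Mn n)‖ + R) ^ 2 * b) *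
      (ε * (∑ k, f k / 4) + gden B f (Zf W) t / ε) := by
  have hR : 0 ≤ R := (norm_nonneg _).trans hW
  have m3 : ∀ a b c : Mn n, ‖a * b * c‖ ≤ ‖a‖ * ‖b‖ * ‖c‖ := fun a b c =>
    (frobenius_norm_mul _ _).trans (by gcongr; exact frobenius_norm_mul _ _)
  have h1 : ‖∑ k, (f k / 4 * rtr n (Zf W * B k t)) • B k t‖ ≤
      b * (ε * (∑ k, f k / 4) + gden B f (Zf W) t / ε) := by
    refine (norm_sum_le _ _).trans ?_
    rw [gden, Finset.sum_div, Finset.mul_sum, ← Finset.sum_add_distrib, Finset.mul_sum]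
    refine Finset.sum_le_sum fun k _ => ?_
    rw [norm_smul, mul_comm]
    have hfk := hf k
    generalize rtr n (Zf W * B k t) = a
    have h2 : ‖f k / 4 * a‖ ≤ ε * (f k / 4) + f k / 4 * a ^ 2 / ε := by
      rw [norm_mul, Real.norm_of_nonneg (by positivity), Real.norm_eq_abs]
      have h3 : |a| ≤ ε + a ^ 2 / ε := by
        rw [← sq_abs a, ← sub_le_iff_le_add', le_div_iff₀ hε]
        nlinarith [sq_nonneg (|a| - ε), abs_nonneg a]
      calc f k / 4 * |a| ≤ f k / 4 * (ε + a ^ 2 / ε) := by gcongr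
        _ = _ := by ring
    exact mul_le_mul (hb k t) h2 (norm_nonneg _) hb0
  have h0 : 0 ≤ b * (ε * (∑ k, f k / 4) + gden B f (Zf W) t / ε) := (norm_nonneg _).trans h1
  have h2 : ‖1 - W‖ ≤ ‖(1 : Mn n)‖ + R := (norm_sub_le _ _).trans (by gcongr)
  have h3 : ‖1 + W‖ ≤ ‖(1 : Mn n)‖ + R := (norm_add_le _ _).trans (by gcongr)
  rw [Wfield, norm_smul]
  have h4 : ‖(1 - W) * (∑ k, (f k / 4 * rtr n (Zf W * B k t)) • B k t) * (1 + W)‖ ≤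
    (‖(1 : Mn n)‖ + R) * (b * (ε * (∑ k, f k / 4) + gden B f (Zf W) t / ε)) * (‖(1 : Mn n)‖ + R) :=
    (m3 _ _ _).trans (by gcongr)
  have h5 : ‖(1 / 2 : ℝ)‖ ≤ 1 := by norm_num
  calc _ ≤ 1 * _ := mul_le_mul h5 h4 (norm_nonneg _) zero_le_one
    _ = _ := by ring

lemma cc_drift {n m : ℕ} (B : Fin m → ℝ → Mn n) (f : Fin m → ℝ) (hf : ∀ k, 0 < f k)
    (b : ℝ) (hb : ∀ k t, ‖B k t‖ ≤ b) (hb0 : 0 ≤ b) (R : ℝ) (W : ℝ → Mn n)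
    (hWR : ∀ t, 0 ≤ t → ‖W t‖ ≤ R)
    (h : ∀ t, 0 ≤ t → HasDerivWithinAt W (Wfield B f (W t) t) (Set.Ici 0) t)
    (s t ε : ℝ) (hs : 0 ≤ s) (hst : s ≤ t) (hε : 0 < ε) :
    ‖W t - W s‖ ≤ ((‖(1 : Mn n)‖ + R) ^ 2 * b) *
      (ε * (∑ k, f k / 4) * (t - s) + (rtr n (-(W s * W s)) - rtr n (-(W t * W t))) / ε) := by
  have hBd : ∀ x, 0 ≤ x → HasDerivWithinAt (fun t => ((‖(1 : Mn n)‖ + R) ^ 2 * b) *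
      (ε * (∑ k, f k / 4) * (t - s) + (rtr n (-(W s * W s)) - rtr n (-(W t * W t))) / ε))
      (((‖(1 : Mn n)‖ + R) ^ 2 * b) *
      (ε * (∑ k, f k / 4) + gden B f (Zf (W x)) x / ε)) (Set.Ici 0) x := by
    intro x hx
    have h1 := V_deriv B f W _ x (h x hx)
    have h2 : HasDerivWithinAt (fun t : ℝ => t - s) 1 (Set.Ici 0) x :=
      (hasDerivWithinAt_id x _).sub_const s
    have h3 := (h2.const_mul (ε * (∑ k, f k / 4))).add
      ((h1.const_sub (rtr n (-(W s * W s)))).div_const ε)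
    refine (h3.const_mul ((‖(1 : Mn n)‖ + R) ^ 2 * b)).congr_deriv ?_
    rw [mul_one, neg_neg]
  refine image_norm_le_of_norm_deriv_right_le_deriv_boundary' (f := fun t => W t - W s)
    (f' := fun x => Wfield B f (W x) x) (a := s) (b := t) ?_ ?_ ?_ ?_ 
    (fun x hx => (hBd x (hs.trans hx.1)).mono (Set.Ici_subset_Ici.2 (hs.trans hx.1))) ?_
    ⟨hst, le_rfl⟩
  · intro x hx
    exact (((h x (hs.trans hx.1)).continuousWithinAt).mono fun y hy => hs.trans hy.1).sub
      continuousWithinAt_const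
  · intro x hx
    exact ((h x (hs.trans hx.1)).mono (Set.Ici_subset_Ici.2 (hs.trans hx.1))).sub_const _
  · simp
  · intro x hx
    exact ((hBd x (hs.trans hx.1)).continuousWithinAt).mono fun y hy => hs.trans hy.1
  · intro x hx
    exact Wfield_bound B f hf b hb hb0 R (W x) (hWR x (hs.trans hx.1)) x ε hε

lemma gden_compare {n m : ℕ} (B : Fin m → ℝ → Mn n) (f : Fin m → ℝ) (hf : ∀ k, 0 < f k)
    (Z Z0 : Mn n) (t c : ℝ) (h1 : ∀ k, |rtr n ((Z - Z0) * B k t)| ≤ c) :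
    gden B f Z0 t ≤ 2 * gden B f Z t + 2 * (∑ k, f k / 4) * c ^ 2 := by
  rw [gden, gden, Finset.mul_sum, Finset.mul_sum, Finset.sum_mul, ← Finset.sum_add_distrib]
  refine Finset.sum_le_sum fun k _ => ?_
  have h2 := h1 k
  rw [sub_mul, map_sub] at h2
  have hfk := hf k
  generalize rtr n (Z * B k t) = x at h2 ⊢
  generalize rtr n (Z0 * B k t) = y at h2 ⊢
  have h3 : (x - y) ^ 2 ≤ c ^ 2 := by
    rw [← sq_abs]
    gcongr
  have h4 : y ^ 2 ≤ 2 * x ^ 2 + 2 * c ^ 2 := by nlinarith [sq_nonneg (2 * x - y)]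
  calc f k / 4 * y ^ 2 ≤ f k / 4 * (2 * x ^ 2 + 2 * c ^ 2) := by gcongr
    _ = _ := by ring

set_option maxHeartbeats 1000000 in
lemma cc_contract {n m : ℕ} (B : Fin m → ℝ → Mn n) (f : Fin m → ℝ) (hf : ∀ k, 0 < f k)
    (T : ℝ) (hT : 0 < T) (hB : ∀ k, Continuous (B k)) (hper : ∀ k t, B k (t + T) = B k t)
    (hnd : ∀ Z : Mn n, Zᴴ = -Z → (∀ k t, rtr n (Z * B k t) = 0) → Z = 0)
    (b : ℝ) (hb : ∀ k t, ‖B k t‖ ≤ b) (hb0 : 0 ≤ b) (W : ℝ → Mn n)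
    (hskew : ∀ t, 0 ≤ t → (W t)ᴴ = -W t)
    (h : ∀ t, 0 ≤ t → HasDerivWithinAt W (Wfield B f (W t) t) (Set.Ici 0) t) :
    ∃ δ : ℝ, 0 < δ ∧ ∀ s, 0 ≤ s → ‖W (s + T)‖ ^ 2 ≤ ‖W s‖ ^ 2 - δ * ‖W s‖ ^ 2 := by
  obtain ⟨q, hq, hq'⟩ := cc_pos B f hf T hT hB hper hnd
  obtain ⟨C, hC, hC'⟩ := rtr_bound n
  obtain ⟨C2, hC2, hC2'⟩ := Zf_lower (n := n)
  obtain ⟨R, hRdef⟩ : ∃ x, x = ‖W 0‖ := ⟨_, rfl⟩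
  have hV : ∀ t, 0 ≤ t → rtr n (-(W t * W t)) = ‖W t‖ ^ 2 := fun t ht => V_eq _ (hskew t ht)
  have hmono : ∀ s t, 0 ≤ s → s ≤ t → ‖W t‖ ^ 2 ≤ ‖W s‖ ^ 2 := by
    intro s t hs hst
    rw [← hV t (hs.trans hst), ← hV s hs]
    exact V_mono B f hf W s t hs hst fun x hx => h x (hs.trans hx.1)
  have hWR : ∀ t, 0 ≤ t → ‖W t‖ ≤ R := fun t ht =>
    by
    rw [hRdef]; exact le_of_sq_le_sq (hmono 0 t le_rfl ht) (norm_nonneg _)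
  have hR0 : 0 ≤ R := by rw [hRdef]; exact norm_nonneg _
  obtain ⟨F, hF⟩ : ∃ x, x = ∑ k, f k / 4 := ⟨_, rfl⟩
  have hF0 : 0 ≤ F := by
    rw [hF]
    exact Finset.sum_nonneg fun k _ => by have := hf k; positivity
  obtain ⟨K, hK⟩ : ∃ x, x = (‖(1 : Mn n)‖ + R) ^ 2 * b := ⟨_, rfl⟩
  have hK0 : 0 ≤ K := by rw [hK]; positivity
  obtain ⟨H, hH⟩ : ∃ x, x = C * ((1 + 3 * R ^ 2) * (K * (F * T + 1)) * b) := ⟨_, rfl⟩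
  have hH0 : 0 ≤ H := by rw [hH]; positivity
  obtain ⟨N, hN⟩ : ∃ x, x = 2 + 2 * F * H ^ 2 * T := ⟨_, rfl⟩
  have hN0 : 0 < N := by rw [hN]; positivity
  refine ⟨q / C2 ^ 2 / N, by positivity, fun s hs => ?_⟩
  have key : ∀ d, 0 < d → ‖W s‖ ^ 2 - ‖W (s + T)‖ ^ 2 ≤ d → q / C2 ^ 2 / N * ‖W s‖ ^ 2 ≤ d := by
    intro d hd hDd
    have hsq : Real.sqrt d * Real.sqrt d = d := Real.mul_self_sqrt hd.le
    have hsp : 0 < Real.sqrt d := Real.sqrt_pos.2 hd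
    -- drift
    have hdr : ∀ t ∈ Set.Icc s (s + T), ‖W t - W s‖ ≤ K * (F * T + 1) * Real.sqrt d := by
      intro t ht
      have h1 := cc_drift B f hf b hb hb0 R W hWR h s t (Real.sqrt d) hs ht.1 hsp
      refine h1.trans ?_
      rw [hV s hs, hV t (hs.trans ht.1), ← hF, ← hK]
      have h2 : (‖W s‖ ^ 2 - ‖W t‖ ^ 2) / Real.sqrt d ≤ Real.sqrt d := by
        rw [div_le_iff₀ hsp, hsq]
        have := hmono t (s + T) (hs.trans ht.1) ht.2
        linarith
      have h3 : Real.sqrt d * F * (t - s) ≤ Real.sqrt d * F * T := by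
        have := ht.2
        gcongr; linarith
      calc _ ≤ K * (Real.sqrt d * F * T + Real.sqrt d) := by gcongr
        _ = _ := by ring
    have hgd : ∀ t ∈ Set.Icc s (s + T), gden B f (Zf (W s)) t ≤
        2 * gden B f (Zf (W t)) t + 2 * F * H ^ 2 * d := by
      intro t ht
      have h1 : ∀ k, |rtr n ((Zf (W t) - Zf (W s)) * B k t)| ≤ H * Real.sqrt d := by
        intro k
        refine (hC' _ _).trans ?_
        have h2 := Zf_lip R (W t) (W s) (hWR t (hs.trans ht.1)) (hWR s hs)
        have h3 : ‖Zf (W t) - Zf (W s)‖ ≤ (1 + 3 * R ^ 2) * (K * (F * T + 1) * Real.sqrt d) := by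
          refine h2.trans ?_
          have := hdr t ht
          gcongr
        calc C * (‖Zf (W t) - Zf (W s)‖ * ‖B k t‖) ≤
            C * (((1 + 3 * R ^ 2) * (K * (F * T + 1) * Real.sqrt d)) * b) := by
              have := hb k t
              gcongr
          _ = H * Real.sqrt d := by rw [hH]; ring
      have h4 := gden_compare B f hf (Zf (W t)) (Zf (W s)) t (H * Real.sqrt d) h1
      have h5 : (H * Real.sqrt d) ^ 2 = H ^ 2 * d := by rw [mul_pow, Real.sq_sqrt hd.le]
      rw [h5, ← hF] at h4
      linarith
    have hG := gden_cont' B f hB (Zf (W s))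
    have hbd : ∀ x, 0 ≤ x → HasDerivWithinAt (fun t => 2 * (‖W s‖ ^ 2 - rtr n (-(W t * W t))) +
        2 * F * H ^ 2 * d * (t - s)) (2 * gden B f (Zf (W x)) x + 2 * F * H ^ 2 * d)
        (Set.Ici 0) x := by
      intro x hx
      have h1 := V_deriv B f W _ x (h x hx)
      have h2 : HasDerivWithinAt (fun t : ℝ => t - s) 1 (Set.Ici 0) x :=
        (hasDerivWithinAt_id x _).sub_const s
      refine (((h1.const_sub (‖W s‖ ^ 2)).const_mul 2).add
        (h2.const_mul (2 * F * H ^ 2 * d))).congr_deriv ?_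
      rw [mul_one, neg_neg]
    have hintg : (∫ t in s..(s + T), gden B f (Zf (W s)) t) ≤
        2 * (‖W s‖ ^ 2 - rtr n (-(W (s + T) * W (s + T)))) +
        2 * F * H ^ 2 * d * ((s + T) - s) := by
      refine image_le_of_deriv_right_le_deriv_boundary
        (f := fun u => ∫ t in s..u, gden B f (Zf (W s)) t)
        (f' := fun u => gden B f (Zf (W s)) u) (a := s) (b := s + T) ?_ ?_ ?_ ?_
        (fun x hx => (hbd x (hs.trans hx.1)).mono (Set.Ici_subset_Ici.2 (hs.trans hx.1)))
        (fun x hx => hgd x ⟨hx.1, hx.2.le⟩) ⟨by linarith, le_rfl⟩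
      · intro x _
        exact (hG.integral_hasStrictDerivAt s x).hasDerivAt.continuousAt.continuousWithinAt
      · intro x _
        exact (hG.integral_hasStrictDerivAt s x).hasDerivAt.hasDerivWithinAt
      · rw [hV s hs]; simp
      · intro x hx
        exact ((hbd x (hs.trans hx.1)).continuousWithinAt).mono fun y hy => hs.trans hy.1
    rw [hV (s + T) (by linarith), (gden_per B f T hper (Zf (W s))).intervalIntegral_add_eq s 0,
      zero_add] at hintg
    have hZs : (Zf (W s))ᴴ = -Zf (W s) := by
      simp only [Zf, conjTranspose_sub, conjTranspose_mul, hskew s hs]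
      noncomm_ring
    have h5 := hq' _ hZs
    have h6 := hC2' _ (hskew s hs)
    have h7 : ‖W s‖ ^ 2 ≤ C2 ^ 2 * ‖Zf (W s)‖ ^ 2 := by
      rw [← mul_pow]; gcongr
    have h8 : q * ‖Zf (W s)‖ ^ 2 ≤ N * d := by
      rw [hN]
      nlinarith
    rw [div_div, div_mul_eq_mul_div, div_le_iff₀ (by positivity)]
    calc q * ‖W s‖ ^ 2 ≤ q * (C2 ^ 2 * ‖Zf (W s)‖ ^ 2) := by gcongr
      _ = C2 ^ 2 * (q * ‖Zf (W s)‖ ^ 2) := by ring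
      _ ≤ C2 ^ 2 * (N * d) := by gcongr
      _ = _ := by ring
  have hfin : q / C2 ^ 2 / N * ‖W s‖ ^ 2 ≤ ‖W s‖ ^ 2 - ‖W (s + T)‖ ^ 2 := by
    refine le_of_forall_pos_le_add fun e he => ?_
    have := hmono s (s + T) hs (by linarith)
    exact key _ (by linarith) (by linarith)
  linarith

/-- Cayley coordinate -/
noncomputable def cay {n : ℕ} (Y : Mn n) : Mn n := 1 - ((Y + 1)⁻¹ + (Y + 1)⁻¹)

lemma cay_inv {n : ℕ} (Y : Mn n) (h : IsUnit (Y + 1)) :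
    (Y + 1)⁻¹ * (Y + 1) = 1 ∧ (Y + 1) * (Y + 1)⁻¹ = 1 := by
  have h' := (Matrix.isUnit_iff_isUnit_det _).1 h
  exact ⟨Matrix.nonsing_inv_mul _ h', Matrix.mul_nonsing_inv _ h'⟩

lemma cay_YP {n : ℕ} (Y : Mn n) (h : IsUnit (Y + 1)) : Y * (Y + 1)⁻¹ = 1 - (Y + 1)⁻¹ := by
  have h2 := (cay_inv Y h).2
  rw [add_mul, one_mul] at h2
  exact eq_sub_of_add_eq h2

lemma cay_PY {n : ℕ} (Y : Mn n) (h : IsUnit (Y + 1)) : (Y + 1)⁻¹ * Y = 1 - (Y + 1)⁻¹ := by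
  have h2 := (cay_inv Y h).1
  rw [mul_add, mul_one] at h2
  exact eq_sub_of_add_eq h2

lemma cay_fb {n : ℕ} (Y : Mn n) (h : IsUnit (Y + 1)) : fbMat Y = (1 / 4 : ℝ) • Zf (cay Y) := by
  have h1 := cay_YP Y h
  have h2 := cay_PY Y h
  rw [fbMat, Zf, cay]
  generalize (Y + 1)⁻¹ = P at *
  have e : Y * (Y - 1) * (P * P * P) = (1 - P) * (1 - (P + P)) * P := by
    have e1 : (Y - 1) * P = 1 - (P + P) := by rw [sub_mul, h1]; noncomm_ring
    have e2 : Y * (1 - (P + P)) * P = (1 - P) * (1 - (P + P)) := by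
      calc Y * (1 - (P + P)) * P = (Y * P) * (1 - (P + P)) := by noncomm_ring
        _ = _ := by rw [h1]
    calc Y * (Y - 1) * (P * P * P) = Y * ((Y - 1) * P) * P * P := by noncomm_ring
      _ = _ := by rw [e1, e2]
  rw [e]
  have e4 : (1 - (P + P)) - (1 - (P + P)) * (1 - (P + P)) * (1 - (P + P)) =
      (4 : ℝ) • ((1 - P) * (1 - (P + P)) * P) := by
    rw [show (4 : ℝ) = ((4 : ℕ) : ℝ) by norm_num, Nat.cast_smul_eq_nsmul]
    noncomm_ring
  rw [e4, smul_smul]; norm_num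

lemma cay_skew {n : ℕ} (Y : Mn n) (h : IsUnit (Y + 1)) (hu : Yᴴ * Y = 1) :
    (cay Y)ᴴ = -cay Y := by
  have h1 := cay_YP Y h
  have h2 := (cay_inv Y h).2
  rw [cay]
  generalize (Y + 1)⁻¹ = P at *
  have e1 : Pᴴ * (Yᴴ + 1) = 1 := by
    have := congrArg conjTranspose h2
    simpa [conjTranspose_mul] using this
  have e2 : Pᴴ = Y * P := by
    calc Pᴴ = Pᴴ * ((Y + 1) * P) := by rw [h2, mul_one]
      _ = Pᴴ * ((Yᴴ * Y + Y) * P) := by rw [hu, add_comm]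
      _ = (Pᴴ * (Yᴴ + 1)) * (Y * P) := by noncomm_ring
      _ = _ := by rw [e1, one_mul]
  simp only [conjTranspose_sub, conjTranspose_add, conjTranspose_one]
  rw [e2, h1]; noncomm_ring

lemma inv_deriv {n : ℕ} {Y : ℝ → Mn n} {Y' : Mn n} {s : Set ℝ} {t : ℝ}
    (h : HasDerivWithinAt Y Y' s t) (hu : IsUnit (Y t)) :
    HasDerivWithinAt (fun t => (Y t)⁻¹) (-((Y t)⁻¹ * Y' * (Y t)⁻¹)) s t := by
  obtain ⟨u, hu⟩ := hu
  have h1 := hasFDerivAt_ringInverse (𝕜 := ℝ) u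
  rw [hu] at h1
  have h2 := h1.comp_hasDerivWithinAt t h
  have e : (Y t)⁻¹ = ((u⁻¹ : (Mn n)ˣ) : Mn n) := by
    rw [Matrix.nonsing_inv_eq_ringInverse, ← hu, Ring.inverse_unit]
  have e2 : (fun t => (Y t)⁻¹) = Ring.inverse ∘ Y := by
    funext x; exact Matrix.nonsing_inv_eq_ringInverse _
  rw [e2, e]
  refine h2.congr_deriv ?_
  simp

lemma cay_deriv {n m : ℕ} (B : Fin m → ℝ → Mn n) (f : Fin m → ℝ) (Y : ℝ → Mn n) (t : ℝ)
    (h : HasDerivWithinAt Y ((∑ k, (f k * rtr n (fbMat (Y t) * B k t)) • B k t) * Y t)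
      (Set.Ici 0) t) (hu : IsUnit (Y t + 1)) :
    HasDerivWithinAt (fun t => cay (Y t)) (Wfield B f (cay (Y t)) t) (Set.Ici 0) t := by
  have h1 : HasDerivWithinAt (fun t => Y t + 1) _ (Set.Ici 0) t := h.add_const 1
  have h2 := inv_deriv h1 hu
  have h3 : HasDerivWithinAt (fun t => cay (Y t)) _ (Set.Ici 0) t := (h2.add h2).const_sub 1
  refine h3.congr_deriv ?_
  have e : (∑ k, (f k * rtr n (fbMat (Y t) * B k t)) • B k t)
      = ∑ k, (f k / 4 * rtr n (Zf (cay (Y t)) * B k t)) • B k t := by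
    refine Finset.sum_congr rfl fun k _ => ?_
    rw [cay_fb _ hu, smul_mul_assoc, map_smul, smul_eq_mul]
    congr 1; ring
  rw [Wfield, e]
  generalize (∑ k, (f k / 4 * rtr n (Zf (cay (Y t)) * B k t)) • B k t) = U
  have h4 := cay_YP _ hu
  rw [cay]
  generalize (Y t + 1)⁻¹ = P at *
  have e5 : P * (U * Y t) * P = P * U * (1 - P) := by
    rw [← h4]; noncomm_ring
  rw [e5]
  have e6 : (1 - (1 - (P + P))) * U * (1 + (1 - (P + P))) = (4 : ℝ) • (P * U * (1 - P)) := by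
    rw [show (4 : ℝ) = ((4 : ℕ) : ℝ) by norm_num, Nat.cast_smul_eq_nsmul]
    noncomm_ring
  rw [e6, smul_smul, show (1 / 2 * 4 : ℝ) = ((2 : ℕ) : ℝ) by norm_num, Nat.cast_smul_eq_nsmul]
  noncomm_ring

lemma cay_unit {n m : ℕ} (B : Fin m → ℝ → Mn n) (f : Fin m → ℝ) (hf : ∀ k, 0 < f k)
    (Y : ℝ → Mn n)
    (hY : ∀ t, 0 ≤ t → HasDerivWithinAt Y ((∑ k, (f k * rtr n (fbMat (Y t) * B k t)) • B k t) * Y t)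
      (Set.Ici 0) t)
    (huni : ∀ t, 0 ≤ t → (Y t)ᴴ * Y t = 1) (h0 : IsUnit (Y 0 + 1)) :
    ∀ t, 0 ≤ t → IsUnit (Y t + 1) := by
  by_contra hcon
  push Not at hcon
  obtain ⟨t0, ht0, hbad⟩ := hcon
  have hYc : ContinuousOn Y (Set.Ici 0) := fun t ht => (hY t ht).continuousWithinAt
  have hdc : ContinuousOn (fun t => (Y t + 1).det) (Set.Ici 0) :=
    (Continuous.matrix_det continuous_id).comp_continuousOn (hYc.add continuousOn_const)
  set D : Set ℝ := Set.Ici 0 ∩ (fun t => (Y t + 1).det) ⁻¹' {0} with hD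
  have hDc : IsClosed D := hdc.preimage_isClosed_of_isClosed isClosed_Ici isClosed_singleton
  have hmem : ∀ t, 0 ≤ t → (t ∈ D ↔ ¬ IsUnit (Y t + 1)) := by
    intro t ht
    rw [Matrix.isUnit_iff_isUnit_det, isUnit_iff_ne_zero, not_not]
    exact ⟨fun h => h.2, fun h => ⟨ht, h⟩⟩
  have hne : D.Nonempty := ⟨t0, (hmem t0 ht0).2 hbad⟩
  have hbdd : BddBelow D := ⟨0, fun x hx => hx.1⟩
  have hτ := hDc.csInf_mem hne hbdd
  set τ := sInf D with hτdef
  have hτ0 : 0 ≤ τ := hτ.1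
  have hτbad : ¬ IsUnit (Y τ + 1) := (hmem τ hτ0).1 hτ
  have hτpos : 0 < τ := lt_of_le_of_ne hτ0 fun h => hτbad (h ▸ h0)
  have hgood : ∀ t, 0 ≤ t → t < τ → IsUnit (Y t + 1) := by
    intro t ht hlt
    by_contra h
    exact absurd (csInf_le hbdd ((hmem t ht).2 h)) (not_le.2 hlt)
  have hWb : ∀ t, 0 ≤ t → t < τ → ‖cay (Y t)‖ ≤ ‖cay (Y 0)‖ := by
    intro t ht hlt
    have h1 := V_mono B f hf (fun t => cay (Y t)) 0 t le_rfl ht fun x hx =>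
      cay_deriv B f Y x (hY x hx.1) (hgood x hx.1 (lt_of_le_of_lt hx.2 hlt))
    simp only [V_eq _ (cay_skew _ (hgood t ht hlt) (huni t ht)),
      V_eq _ (cay_skew _ h0 (huni 0 le_rfl))] at h1
    exact le_of_sq_le_sq h1 (norm_nonneg _)
  obtain ⟨R, hR⟩ : ∃ R, R = ‖(1 : Mn n)‖ + ‖cay (Y 0)‖ + 1 := ⟨_, rfl⟩
  have hRpos : 0 < R := by rw [hR]; positivity
  have hPb : ∀ t, 0 ≤ t → t < τ → ‖(Y t + 1)⁻¹‖ ≤ R := by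
    intro t ht hlt
    have e : (Y t + 1)⁻¹ = (1 / 2 : ℝ) • (1 - cay (Y t)) := by
      rw [cay, sub_sub_cancel, ← two_smul ℝ, smul_smul]; norm_num
    rw [e, norm_smul]
    have h1 := norm_sub_le (1 : Mn n) (cay (Y t))
    have h2 := hWb t ht hlt
    have h3 : ‖(1 / 2 : ℝ)‖ = 1 / 2 := by norm_num
    have h4 := norm_nonneg (1 - cay (Y t))
    rw [h3]
    linarith
  -- pick a time close to τ
  obtain ⟨δ, hδ, hclose⟩ := Metric.continuousWithinAt_iff.1 (hYc τ hτ0) (1 / R) (by positivity)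
  obtain ⟨t, ht1, ht2⟩ := exists_between (max_lt hτpos (by linarith : τ - δ < τ))
  have ht0 : 0 ≤ t := (le_max_left _ _).trans ht1.le
  have htd : τ - δ < t := (le_max_right _ _).trans_lt ht1
  have hdist := hclose (x := t) ht0 (by rw [Real.dist_eq, abs_lt]; constructor <;> linarith)
  rw [dist_eq_norm] at hdist
  have hsmall : ‖(Y t + 1)⁻¹ * (Y t - Y τ)‖ < 1 := by
    refine (frobenius_norm_mul _ _).trans_lt ?_
    calc ‖(Y t + 1)⁻¹‖ * ‖Y t - Y τ‖ ≤ R * ‖Y t - Y τ‖ := by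
          gcongr; exact hPb t ht0 ht2
      _ < R * (1 / R) := by gcongr
      _ = 1 := by field_simp
  have hu := isUnit_one_sub_of_norm_lt_one hsmall
  have e : 1 - (Y t + 1)⁻¹ * (Y t - Y τ) = (Y t + 1)⁻¹ * (Y τ + 1) := by
    have := (cay_inv _ (hgood t ht0 ht2)).1
    calc 1 - (Y t + 1)⁻¹ * (Y t - Y τ) = (Y t + 1)⁻¹ * (Y t + 1) - (Y t + 1)⁻¹ * (Y t - Y τ) := by
          rw [this]
      _ = _ := by noncomm_ring
  rw [e] at hu
  apply hτbad
  have := (hgood t ht0 ht2).mul hu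
  rwa [← mul_assoc, (cay_inv _ (hgood t ht0 ht2)).2, one_mul] at this

set_option maxHeartbeats 1000000 in
lemma main_aux
    (n m : ℕ) (hn : 1 ≤ n) (T : ℝ) (hT : 0 < T)
    (S : Fin m → Matrix (Fin n) (Fin n) ℂ)
    (hS : ∀ k, (S k)ᴴ = -(S k))
    (f : Fin m → ℝ) (hf : ∀ k, 0 < f k)
    (Xgoal : Matrix (Fin n) (Fin n) ℂ)
    (hXgoal : Xgoal ∈ Matrix.unitaryGroup (Fin n) ℂ)
    (hdet : (1 + Xgoal).det ≠ 0)
    -- the Coron reference controls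
    (ubar : Fin m → ℝ → ℝ)
    (hsmooth : ∀ k, ContDiff ℝ (⊤ : ℕ∞) (ubar k))
    (hper : ∀ k t, ubar k (t + T) = ubar k t)
    (hodd : ∀ k t, ubar k (T - t) = -(ubar k t))
    (hCoron : (Submodule.span ℝ
        {B : Matrix (Fin n) (Fin n) ℂ |
          ∃ (k : Fin m) (j : ℕ), Cmat (fun t => ∑ k', ubar k' t • S k') (S k) j 0 = B} :
        Set (Matrix (Fin n) (Fin n) ℂ)) = {B | Bᴴ = -B})
    -- the reference trajectory through the identity and through the goal
    (XbarI : ℝ → Matrix (Fin n) (Fin n) ℂ)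
    (hXbarI0 : XbarI 0 = 1)
    (hXbarIode : ∀ t, HasDerivAt XbarI (∑ k, ubar k t • (S k * XbarI t)) t)
    (Xbar : ℝ → Matrix (Fin n) (Fin n) ℂ)
    (hXbar : Xbar = fun t => XbarI t * Xgoal)
    -- the closed-loop trajectory
    (X : ℝ → Matrix (Fin n) (Fin n) ℂ)
    (hX0 : X 0 = 1)
    (hXode : ∀ t ∈ Set.Ici (0 : ℝ), HasDerivWithinAt X
      (∑ k, (ubar k t + utildeFb (f k) (S k) Xbar ((Xbar t)ᴴ * X t) t) • (S k * X t))
      (Set.Ici (0 : ℝ)) t) :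
    ∃ (c lam : ℝ), 0 < c ∧ 0 < lam ∧
      ∀ j : ℕ, frobNorm (X (j * T) - Xgoal) ≤ c * Real.exp (-lam * j) := by
  obtain ⟨A, hA⟩ : ∃ A : ℝ → Mn n, A = fun t => ∑ k', ubar k' t • S k' := ⟨_, rfl⟩
  rw [← hA] at hCoron
  have skew_sum : ∀ c : Fin m → ℝ, (∑ k, c k • S k)ᴴ = -(∑ k, c k • S k) := by
    intro c
    rw [conjTranspose_sum, ← Finset.sum_neg_distrib]
    exact Finset.sum_congr rfl fun k _ => by rw [conjTranspose_smul, hS k]; simp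
  have hAskew : ∀ t, (A t)ᴴ = -(A t) := fun t => by rw [hA]; exact skew_sum _
  have hAs : ContDiff ℝ (⊤ : ℕ∞) A := by
    rw [hA]
    exact ContDiff.sum fun k _ => (hsmooth k).smul contDiff_const
  have hAper : ∀ t, A (t + T) = A t := fun t => by simp only [hA, hper]
  have hAodd : ∀ t, A (T - t) = -A t := fun t => by
    simp only [hA, hodd, neg_smul, Finset.sum_neg_distrib]
  have hP : ∀ t, HasDerivAt XbarI (A t * XbarI t) t := by
    intro t
    refine (hXbarIode t).congr_deriv ?_
    rw [hA, Finset.sum_mul]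
    exact Finset.sum_congr rfl fun k _ => by rw [smul_mul_assoc]
  obtain ⟨hPu, hPper⟩ := cc_ref A XbarI T hAskew hAper hAodd hP hXbarI0
  have hgu : Xgoalᴴ * Xgoal = 1 := (Matrix.mem_unitaryGroup_iff').1 hXgoal
  have hU : ∀ t, HasDerivAt Xbar (A t * Xbar t) t := by
    intro t
    have h1 := cc_mul ((hP t).hasDerivWithinAt (s := Set.univ))
      (hasDerivWithinAt_const t Set.univ Xgoal)
    rw [hXbar]
    refine hasDerivWithinAt_univ.1 (h1.congr_deriv ?_)
    noncomm_ring
  have hUu : ∀ t, (Xbar t)ᴴ * Xbar t = 1 := by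
    intro t
    rw [hXbar]
    calc (XbarI t * Xgoal)ᴴ * (XbarI t * Xgoal) = Xgoalᴴ * ((XbarI t)ᴴ * XbarI t) * Xgoal := by
          rw [conjTranspose_mul]; noncomm_ring
      _ = 1 := by rw [hPu, mul_one, hgu]
  have hUu' : ∀ t, Xbar t * (Xbar t)ᴴ = 1 := fun t => mul_eq_one_comm.mp (hUu t)
  have hU0 : Xbar 0 = Xgoal := by rw [hXbar]; simp [hXbarI0]
  have hUper : ∀ t, Xbar (t + T) = Xbar t := fun t => by simp only [hXbar, hPper]
  have hUj : ∀ j : ℕ, Xbar (j * T) = Xgoal := by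
    intro j
    induction j with
    | zero => simpa using hU0
    | succ j ih => rw [← ih, ← hUper (j * T)]; congr 1; push_cast; ring
  have hUc : Continuous Xbar := continuous_iff_continuousAt.2 fun t => (hU t).continuousAt
  have norm_u : ∀ M : Mn n, Mᴴ * M = 1 → ‖M‖ ≤ ‖(1 : Mn n)‖ := by
    intro M hM
    refine le_of_sq_le_sq ?_ (norm_nonneg _)
    rw [cc_norm_sq, cc_norm_sq, hM]; simp
  obtain ⟨B, hBdef⟩ : ∃ B : Fin m → ℝ → Mn n, B = fun k t => (Xbar t)ᴴ * S k * Xbar t := ⟨_, rfl⟩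
  have hBc : ∀ k, Continuous (B k) := by
    intro k
    rw [hBdef]
    have h1 : Continuous fun t => (Xbar t)ᴴ := continuous_star.comp hUc
    exact (h1.mul continuous_const).mul hUc
  have hBper : ∀ k t, B k (t + T) = B k t := fun k t => by simp only [hBdef, hUper]
  obtain ⟨b, hb0, hb⟩ : ∃ b : ℝ, 0 ≤ b ∧ ∀ k t, ‖B k t‖ ≤ b := by
    refine ⟨∑ k, ‖(1 : Mn n)‖ * ‖S k‖ * ‖(1 : Mn n)‖, Finset.sum_nonneg fun k _ => by positivity,
      fun k t => ?_⟩
    refine le_trans ?_ (Finset.single_le_sum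
      (f := fun k => ‖(1 : Mn n)‖ * ‖S k‖ * ‖(1 : Mn n)‖) (fun k _ => by positivity)
      (Finset.mem_univ k))
    rw [hBdef]
    have h1 := norm_u _ (hUu t)
    have h2 : ‖(Xbar t)ᴴ‖ ≤ ‖(1 : Mn n)‖ := by rw [frobenius_norm_conjTranspose]; exact h1
    refine (frobenius_norm_mul _ _).trans ?_
    have h3 := frobenius_norm_mul (Xbar t)ᴴ (S k)
    have h4 : ‖(Xbar t)ᴴ * S k‖ ≤ ‖(1 : Mn n)‖ * ‖S k‖ := h3.trans (by gcongr)
    gcongr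
  have hnd : ∀ Z : Mn n, Zᴴ = -Z → (∀ k t, rtr n (Z * B k t) = 0) → Z = 0 := by
    intro Z hZ h0
    rw [hBdef] at h0
    exact cc_nondeg A Xbar S Z hAs hAskew hU (hUu' 0) (hUu 0) hCoron hZ h0
  -- the closed loop
  obtain ⟨v, hv⟩ : ∃ v : Fin m → ℝ → ℝ,
      v = fun k t => utildeFb (f k) (S k) Xbar ((Xbar t)ᴴ * X t) t := ⟨_, rfl⟩
  have hX : ∀ t, 0 ≤ t →
      HasDerivWithinAt X ((∑ k, (ubar k t + v k t) • S k) * X t) (Set.Ici 0) t := by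
    intro t ht
    refine (hXode t ht).congr_deriv ?_
    rw [Finset.sum_mul, hv]
    exact Finset.sum_congr rfl fun k _ => by rw [smul_mul_assoc]
  have hXu : ∀ t, 0 ≤ t → (X t)ᴴ * X t = 1 := by
    intro t ht
    have hd : ∀ x, 0 ≤ x → HasDerivWithinAt (fun t => (X t)ᴴ * X t) 0 (Set.Ici 0) x :=
      fun x hx => cc_skew (skew_sum _) (hX x hx) (hX x hx)
    have h1 := constant_of_has_deriv_right_zero (f := fun t => (X t)ᴴ * X t) (a := 0) (b := t)
      (fun x hx => ((hd x hx.1).continuousWithinAt).mono fun y hy => hy.1)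
      (fun x hx => (hd x hx.1).mono (Set.Ici_subset_Ici.2 hx.1)) t ⟨ht, le_rfl⟩
    simpa [hX0] using h1
  obtain ⟨Y, hYdef⟩ : ∃ Y : ℝ → Mn n, Y = fun t => (Xbar t)ᴴ * X t := ⟨_, rfl⟩
  have hYu : ∀ t, 0 ≤ t → (Y t)ᴴ * Y t = 1 := by
    intro t ht
    rw [hYdef]
    calc ((Xbar t)ᴴ * X t)ᴴ * ((Xbar t)ᴴ * X t) = (X t)ᴴ * (Xbar t * (Xbar t)ᴴ) * X t := by
          rw [conjTranspose_mul, conjTranspose_conjTranspose]; noncomm_ring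
      _ = 1 := by rw [hUu', mul_one, hXu t ht]
  have hv' : ∀ k t, v k t = f k * rtr n (fbMat (Y t) * B k t) := by
    intro k t
    rw [hv, hYdef, hBdef]; rfl
  have hY : ∀ t, 0 ≤ t → HasDerivWithinAt Y
      ((∑ k, (f k * rtr n (fbMat (Y t) * B k t)) • B k t) * Y t) (Set.Ici 0) t := by
    intro t ht
    have h1 := cc_mul (cc_star ((hU t).hasDerivWithinAt (s := Set.Ici 0))) (hX t ht)
    rw [← hYdef] at h1
    refine h1.congr_deriv ?_
    have e1 : (∑ k, (ubar k t + v k t) • S k) = A t + ∑ k, v k t • S k := by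
      rw [hA]; simp only [add_smul, Finset.sum_add_distrib]
    have e2 : (∑ k, (f k * rtr n (fbMat (Y t) * B k t)) • B k t)
        = (Xbar t)ᴴ * (∑ k, v k t • S k) * Xbar t := by
      rw [Finset.mul_sum, Finset.sum_mul]
      refine Finset.sum_congr rfl fun k _ => ?_
      rw [← hv', mul_smul_comm, smul_mul_assoc, hBdef]
    rw [e1, e2, conjTranspose_mul, hAskew, hYdef]
    generalize (∑ k, v k t • S k) = G
    calc (Xbar t)ᴴ * -A t * X t + (Xbar t)ᴴ * ((A t + G) * X t)
        = (Xbar t)ᴴ * G * 1 * X t := by noncomm_ring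
      _ = _ := by rw [← hUu' t]; noncomm_ring
  have hY0 : IsUnit (Y 0 + 1) := by
    have e : Y 0 + 1 = (1 + Xgoal)ᴴ := by
      rw [hYdef]; simp [hU0, hX0, add_comm]
    rw [e, Matrix.isUnit_iff_isUnit_det, isUnit_iff_ne_zero, det_conjTranspose]
    exact star_ne_zero.2 hdet
  have hYi := cay_unit B f hf Y hY hYu hY0
  obtain ⟨δ, hδ, hcon⟩ := cc_contract B f hf T hT hBc hBper hnd b hb hb0 (fun t => cay (Y t))
    (fun t ht => cay_skew _ (hYi t ht) (hYu t ht))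
    (fun t ht => cay_deriv B f Y t (hY t ht) (hYi t ht))
  have hiter : ∀ j : ℕ, ‖cay (Y (j * T))‖ ^ 2 ≤ Real.exp (-δ * j) * ‖cay (Y 0)‖ ^ 2 := by
    intro j
    induction j with
    | zero => simp
    | succ j ih =>
      have h1 := hcon (j * T) (by positivity)
      have e : ((j + 1 : ℕ) : ℝ) * T = j * T + T := by push_cast; ring
      rw [e]
      have h2 : 1 - δ ≤ Real.exp (-δ) := by have := Real.add_one_le_exp (-δ); linarith
      calc ‖cay (Y (j * T + T))‖ ^ 2 ≤ (1 - δ) * ‖cay (Y (j * T))‖ ^ 2 := by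
            refine h1.trans (le_of_eq ?_); ring
        _ ≤ Real.exp (-δ) * ‖cay (Y (j * T))‖ ^ 2 := by gcongr
        _ ≤ Real.exp (-δ) * (Real.exp (-δ * j) * ‖cay (Y 0)‖ ^ 2) := by gcongr
        _ = _ := by rw [← mul_assoc, ← Real.exp_add]; congr 2; push_cast; ring
  refine ⟨‖Xgoal‖ * (‖cay (Y 0)‖ * (‖(1 : Mn n)‖ + ‖(1 : Mn n)‖)) + 1, δ / 2, by positivity,
    by positivity, fun j => ?_⟩
  have hjT : (0 : ℝ) ≤ j * T := by positivity
  have h1 : ‖cay (Y (j * T))‖ ≤ Real.exp (-(δ / 2) * j) * ‖cay (Y 0)‖ := by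
    refine le_of_sq_le_sq ?_ (by positivity)
    refine (hiter j).trans (le_of_eq ?_)
    rw [mul_pow, ← Real.exp_nat_mul]
    congr 2; push_cast; ring
  have e1 : X (j * T) - Xgoal = Xgoal * (cay (Y (j * T)) * (Y (j * T) + 1)) := by
    have e2 : cay (Y (j * T)) * (Y (j * T) + 1) = Y (j * T) - 1 := by
      rw [cay, sub_mul, add_mul, (cay_inv _ (hYi _ hjT)).1]; noncomm_ring
    have e3 : Xgoal * Y (j * T) = X (j * T) := by
      rw [hYdef]
      simp only []
      rw [← mul_assoc, ← hUj j, hUu', one_mul]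
    rw [e2, mul_sub, e3, mul_one]
  rw [cc_frob, e1]
  have h2 : ‖Y (j * T) + 1‖ ≤ ‖(1 : Mn n)‖ + ‖(1 : Mn n)‖ :=
    (norm_add_le _ _).trans (by gcongr; exact norm_u _ (hYu _ hjT))
  have h3 : ‖cay (Y (j * T)) * (Y (j * T) + 1)‖ ≤
      (Real.exp (-(δ / 2) * j) * ‖cay (Y 0)‖) * (‖(1 : Mn n)‖ + ‖(1 : Mn n)‖) :=
    (frobenius_norm_mul _ _).trans (by gcongr)
  have h4 := Real.exp_pos (-(δ / 2) * j)
  calc _ ≤ ‖Xgoal‖ * ‖cay (Y (j * T)) * (Y (j * T) + 1)‖ := frobenius_norm_mul _ _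
    _ ≤ ‖Xgoal‖ * ((Real.exp (-(δ / 2) * j) * ‖cay (Y 0)‖) * (‖(1 : Mn n)‖ + ‖(1 : Mn n)‖)) := by
        gcongr
    _ ≤ _ := by nlinarith

end Helpers

/-- Exponential convergence, deterministic case.  Under the hypotheses of
the main deterministic stabilization theorem, the convergence of `X(jT)` to `X_goal` is
exponential: there are `c > 0` and `λ > 0` with `‖X(jT) - X_goal‖ ≤ c e^{-λ j}`. -/
theorem deterministic_exponential_convergence
    (n m : ℕ) (hn : 1 ≤ n) (T : ℝ) (hT : 0 < T)
    (S : Fin m → Matrix (Fin n) (Fin n) ℂ)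
    (hS : ∀ k, (S k)ᴴ = -(S k))
    (f : Fin m → ℝ) (hf : ∀ k, 0 < f k)
    (Xgoal : Matrix (Fin n) (Fin n) ℂ)
    (hXgoal : Xgoal ∈ Matrix.unitaryGroup (Fin n) ℂ)
    (hdet : (1 + Xgoal).det ≠ 0)
    -- the Coron reference controls
    (ubar : Fin m → ℝ → ℝ)
    (hsmooth : ∀ k, ContDiff ℝ (⊤ : ℕ∞) (ubar k))
    (hper : ∀ k t, ubar k (t + T) = ubar k t)
    (hodd : ∀ k t, ubar k (T - t) = -(ubar k t))
    (hCoron : (Submodule.span ℝ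
        {B : Matrix (Fin n) (Fin n) ℂ |
          ∃ (k : Fin m) (j : ℕ), Cmat (fun t => ∑ k', ubar k' t • S k') (S k) j 0 = B} :
        Set (Matrix (Fin n) (Fin n) ℂ)) = {B | Bᴴ = -B})
    -- the reference trajectory through the identity and through the goal
    (XbarI : ℝ → Matrix (Fin n) (Fin n) ℂ)
    (hXbarI0 : XbarI 0 = 1)
    (hXbarIode : ∀ t, HasDerivAt XbarI (∑ k, ubar k t • (S k * XbarI t)) t)
    (Xbar : ℝ → Matrix (Fin n) (Fin n) ℂ)
    (hXbar : Xbar = fun t => XbarI t * Xgoal)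
    -- the closed-loop trajectory
    (X : ℝ → Matrix (Fin n) (Fin n) ℂ)
    (hX0 : X 0 = 1)
    (hXode : ∀ t ∈ Set.Ici (0 : ℝ), HasDerivWithinAt X
      (∑ k, (ubar k t + utildeFb (f k) (S k) Xbar ((Xbar t)ᴴ * X t) t) • (S k * X t))
      (Set.Ici (0 : ℝ)) t) :
    ∃ (c lam : ℝ), 0 < c ∧ 0 < lam ∧
      ∀ j : ℕ, frobNorm (X (j * T) - Xgoal) ≤ c * Real.exp (-lam * j) := by
  exact main_aux n m hn T hT S hS f hf Xgoal hXgoal hdet ubar hsmooth hper hodd hCoron XbarI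
    hXbarI0 hXbarIode Xbar hXbar X hX0 hXode
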